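/- Let β > 0 and K > 0, let X be a compact length space, Y ⊆ X a nonempty closed subset, F : Y → ℝ Lipschitz, and M = sup_Y F − inf_Y F. There exist constants C > 0 and ε₀ > 0 such that for every ε ∈ (0,ε₀) and every θ ∈ (0,1) with |θ − βε/2| ≤ Kε², the unique bounded (θ,ε)-infinity harmonic extension u^ε of F satisfies: for all x₁, x₂ ∈ X∖Y with 2ε < min{d(x₁,Y), d(x₂,Y)} and s := max{d(x₁,Y), d(x₂,Y)}, |u^ε(x₁) − u^ε(x₂)| ≤ C · d^ε(x₁,x₂) · M/s. -/

import Mathlib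

open Set Metric Filter

noncomputable section

/-- A metric space is a **length space** if the distance between any two points equals the
infimum of the lengths of continuous paths joining them. -/
def IsLengthSpace (X : Type*) [MetricSpace X] : Prop :=
  ∀ x y : X, edist x y = ⨅ γ : Path x y, eVariationOn (fun t => γ t) Set.univ

/-- `u` is `(θ, ε)`-infinity harmonic on `S`: for every `x ∈ S` the supremum and infimum of `u`
over the open ball `B_ε(x)` are finite and
`u(x) = ((1+θ)/2)·sup_{B_ε(x)} u + ((1−θ)/2)·inf_{B_ε(x)} u`. -/
def InfinityHarmonicOn {X : Type*} [MetricSpace X] (θ ε : ℝ) (S : Set X) (u : X → ℝ) : Prop :=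
  ∀ x ∈ S, BddAbove (u '' ball x ε) ∧ BddBelow (u '' ball x ε) ∧
    u x = ((1 + θ) / 2) * sSup (u '' ball x ε) + ((1 - θ) / 2) * sInf (u '' ball x ε)

/-- `φ` is a **β-exponential cone** centered at `x₀`:
`φ(x) = sgn(β)·A·(1 − e^{−β d(x₀,x)}) + B` (positive cone) or
`φ(x) = sgn(β)·A·(1 − e^{β d(x₀,x)}) + B` (negative cone), with `A ≥ 0`, `B ∈ ℝ`. -/
def IsExpCone {X : Type*} [MetricSpace X] (β : ℝ) (x₀ : X) (φ : X → ℝ) : Prop :=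
  ∃ A B : ℝ, 0 ≤ A ∧
    ((∀ x, φ x = Real.sign β * A * (1 - Real.exp (-β * dist x₀ x)) + B) ∨
     (∀ x, φ x = Real.sign β * A * (1 - Real.exp (β * dist x₀ x)) + B))

/-- Comparison with β-exponential cones **from above** on `X ∖ Y`. -/
def CECA {X : Type*} [MetricSpace X] (β : ℝ) (Y : Set X) (u : X → ℝ) : Prop :=
  ∀ V : Set X, IsOpen V → V ⊆ Yᶜ → (∃ r > 0, ∀ v ∈ V, ∀ y ∈ Y, r ≤ dist v y) →
    ∀ x₀ : X, ∀ φ : X → ℝ, IsExpCone β x₀ φ →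
      (∀ x ∈ frontier (V \ {x₀}), u x ≤ φ x) → ∀ x ∈ V, u x ≤ φ x

/-- Comparison with β-exponential cones **from below** on `X ∖ Y`. -/
def CECB {X : Type*} [MetricSpace X] (β : ℝ) (Y : Set X) (u : X → ℝ) : Prop :=
  ∀ V : Set X, IsOpen V → V ⊆ Yᶜ → (∃ r > 0, ∀ v ∈ V, ∀ y ∈ Y, r ≤ dist v y) →
    ∀ x₀ : X, ∀ φ : X → ℝ, IsExpCone β x₀ φ →
      (∀ x ∈ frontier (V \ {x₀}), φ x ≤ u x) → ∀ x ∈ V, φ x ≤ u x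

/-- Comparison with β-exponential cones on `X ∖ Y`. -/
def CEC {X : Type*} [MetricSpace X] (β : ℝ) (Y : Set X) (u : X → ℝ) : Prop :=
  CECA β Y u ∧ CECB β Y u

open Classical in
/-- The modified metric `d^ε`: `d^ε(x,y) = ε + ε⌊d(x,y)/ε⌋` for `x ≠ y`, `d^ε(x,x) = 0`. -/
noncomputable def dEps {X : Type*} [MetricSpace X] (ε : ℝ) (x y : X) : ℝ :=
  if x = y then 0 else ε + ε * (⌊dist x y / ε⌋ : ℝ)

/-- `d^ε(X) = sup_{x₁,x₂ ∈ X} d^ε(x₁,x₂)`. -/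
noncomputable def dEpsDiam (X : Type*) [MetricSpace X] (ε : ℝ) : ℝ :=
  ⨆ p : X × X, dEps ε p.1 p.2

/-- `ρ` satisfies condition (⋆) for `β`: `ρ` is a smooth positive function on a neighbourhood of
`0` with `ρ(0) = 1`, `ρ′(0) = β`, whose logarithm is concave or convex. -/
def OddsCondition (β : ℝ) (ρ : ℝ → ℝ) : Prop :=
  ∃ a : ℝ, 0 < a ∧ ContDiffOn ℝ (⊤ : ℕ∞) ρ (Ioo (-a) a) ∧ (∀ x ∈ Ioo (-a) a, 0 < ρ x) ∧
    ρ 0 = 1 ∧ deriv ρ 0 = β ∧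
    (ConvexOn ℝ (Ioo (-a) a) (fun x => Real.log (ρ x)) ∨
     ConcaveOn ℝ (Ioo (-a) a) (fun x => Real.log (ρ x)))

end

/-- In a length space, a distance smaller than `a + b` can be split by an intermediate point. -/
lemma IsLengthSpace.exists_dist_lt_dist_lt {X : Type*} [MetricSpace X] (hX : IsLengthSpace X)
    {x y : X} {a b : ℝ} (ha : 0 < a) (hb : 0 < b) (h : dist x y < a + b) :
    ∃ z, dist x z < a ∧ dist z y < b := by
  by_cases hxy : dist x y < a
  · exact ⟨y, hxy, by simpa using hb⟩
  push Not at hxy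
  have h1 : (⨅ γ : Path x y, eVariationOn (fun t => γ t) Set.univ) < ENNReal.ofReal (a + b) := by
    rw [← hX x y, edist_dist]
    exact (ENNReal.ofReal_lt_ofReal_iff (by linarith)).2 h
  obtain ⟨γ, hγ⟩ := iInf_lt_iff.1 h1
  set l := (eVariationOn (fun t => γ t) Set.univ).toReal with hl
  have hfin : eVariationOn (fun t => γ t) Set.univ ≠ ⊤ := ne_top_of_lt hγ
  have hlab : l < a + b := by
    have := (ENNReal.toReal_lt_toReal hfin ENNReal.ofReal_ne_top).2 hγ
    rwa [ENNReal.toReal_ofReal (by linarith)] at this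
  obtain ⟨c, hc1, hc2⟩ : ∃ c, max 0 (l - b) < c ∧ c < a :=
    exists_between (max_lt ha (by linarith))
  have hc0 : 0 < c := (le_max_left _ _).trans_lt hc1
  have hcl : l - b < c := (le_max_right _ _).trans_lt hc1
  have hcont : Continuous (fun t => dist x (γ t)) := by fun_prop
  obtain ⟨t, ht⟩ : ∃ t, dist x (γ t) = c :=
    mem_range_of_exists_le_of_exists_ge hcont ⟨0, by simpa using hc0.le⟩
      ⟨1, by simpa using hc2.le.trans hxy⟩
  refine ⟨γ t, by linarith, ?_⟩
  have hsum : edist x (γ t) + edist (γ t) y ≤ eVariationOn (fun t => γ t) Set.univ := by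
    have e1 : edist x (γ t) ≤ eVariationOn (fun t => γ t) (Set.univ ∩ Set.Iic t) := by
      have := eVariationOn.edist_le (fun t => γ t) (s := Set.univ ∩ Set.Iic t)
        (x := 0) (y := t) ⟨trivial, t.2.1⟩ ⟨trivial, le_refl t⟩
      simpa using this
    have e2 : edist (γ t) y ≤ eVariationOn (fun t => γ t) (Set.univ ∩ Set.Ici t) := by
      have := eVariationOn.edist_le (fun t => γ t) (s := Set.univ ∩ Set.Ici t)
        (x := t) (y := 1) ⟨trivial, le_refl t⟩ ⟨trivial, t.2.2⟩
      simpa using this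
    refine (add_le_add e1 e2).trans ?_
    refine (eVariationOn.add_le_union _ ?_).trans (eVariationOn.mono _ (Set.subset_univ _))
    exact fun p hp q hq => hp.2.trans hq.2
  have hsum' : dist x (γ t) + dist (γ t) y ≤ l := by
    have := ENNReal.toReal_mono hfin hsum
    rwa [ENNReal.toReal_add (edist_ne_top _ _) (edist_ne_top _ _), ← dist_edist,
      ← dist_edist] at this
  linarith

/-- Maximum principle: if a bounded function lies below a fixed convex combination of its
supremum and any value in the `ε`-ball, then it is bounded by its values on `Y`. -/
lemma IsLengthSpace.le_of_le_combination {X : Type*} [MetricSpace X] [CompactSpace X]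
    (hX : IsLengthSpace X) {Y : Set X} (hY : Y.Nonempty) {v : X → ℝ} {ε q T : ℝ}
    (hε : 0 < ε) (hq : 0 < q) (hq1 : q ≤ 1) (hv : BddAbove (Set.range v))
    (hT : ∀ y ∈ Y, v y ≤ T)
    (h : ∀ x ∉ Y, ∀ y ∈ ball x ε, v x ≤ (1 - q) * (⨆ z, v z) + q * v y) (x : X) : v x ≤ T := by
  set S := ⨆ z, v z with hS
  by_contra! hx
  have hTS : T < S := hx.trans_le (le_ciSup hv x)
  have key : ∀ n : ℕ, ∀ x, (∃ y ∈ Y, dist x y < n * ε) → v x ≤ S - q ^ n * (S - T) := by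
    intro n
    induction n with
    | zero =>
      rintro x ⟨y, -, hy⟩
      have := dist_nonneg (x := x) (y := y)
      simp at hy
      linarith
    | succ n ih =>
      rintro x ⟨y, hyY, hy⟩
      by_cases hxY : x ∈ Y
      · have h1 := hT x hxY
        have h2 : q ^ (n + 1) ≤ 1 := pow_le_one₀ hq.le hq1
        nlinarith
      obtain ⟨z, hz, hvz⟩ : ∃ z ∈ ball x ε, v z ≤ S - q ^ n * (S - T) := by
        rcases n.eq_zero_or_pos with rfl | hn
        · exact ⟨y, by simpa [dist_comm] using hy, by simpa using hT y hyY⟩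
        · have hn' : (0 : ℝ) < n := by exact_mod_cast hn
          obtain ⟨z, hz1, hz2⟩ := hX.exists_dist_lt_dist_lt (x := x) (y := y) hε
            (mul_pos hn' hε) (by push_cast at hy; linarith)
          exact ⟨z, by simpa [dist_comm] using hz1, ih z ⟨y, hyY, hz2⟩⟩
      have h1 := h x hxY z hz
      have h2 := mul_le_mul_of_nonneg_left hvz hq.le
      rw [pow_succ]
      linarith
  obtain ⟨N, hN⟩ := exists_nat_gt (diam (Set.univ : Set X) / ε)
  rw [div_lt_iff₀ hε] at hN
  obtain ⟨y, hy⟩ := hY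
  have hle : S ≤ S - q ^ N * (S - T) := by
    have : Nonempty X := ⟨x⟩
    refine ciSup_le fun z => key N z ⟨y, hy, ?_⟩
    exact (dist_le_diam_of_mem isCompact_univ.isBounded trivial trivial).trans_lt hN
  have := mul_pos (pow_pos hq N) (sub_pos.2 hTS)
  linarith

lemma InfinityHarmonicOn.le_sSup {X : Type*} [MetricSpace X] {θ ε : ℝ} {S : Set X} {u : X → ℝ}
    (hu : InfinityHarmonicOn θ ε S u) {x y : X} (hx : x ∈ S) (hy : y ∈ ball x ε) :
    u y ≤ sSup (u '' ball x ε) :=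
  le_csSup (hu x hx).1 (mem_image_of_mem u hy)

lemma InfinityHarmonicOn.sInf_le {X : Type*} [MetricSpace X] {θ ε : ℝ} {S : Set X} {u : X → ℝ}
    (hu : InfinityHarmonicOn θ ε S u) {x y : X} (hx : x ∈ S) (hy : y ∈ ball x ε) :
    sInf (u '' ball x ε) ≤ u y :=
  csInf_le (hu x hx).2.1 (mem_image_of_mem u hy)

/-- A bounded infinity harmonic function is bounded above by its values on `Y`. -/
lemma InfinityHarmonicOn.le_of_forall_le {X : Type*} [MetricSpace X] [CompactSpace X]
    (hX : IsLengthSpace X) {Y : Set X} (hY : Y.Nonempty) {u : X → ℝ} {θ ε T : ℝ}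
    (hε : 0 < ε) (hθ : -1 ≤ θ) (hθ1 : θ < 1) (hu : InfinityHarmonicOn θ ε Yᶜ u)
    (hb : BddAbove (Set.range u)) (hT : ∀ y ∈ Y, u y ≤ T) (x : X) : u x ≤ T := by
  refine hX.le_of_le_combination hY (q := (1 - θ) / 2) hε (by linarith) (by linarith) hb hT
    (fun x hx y hy => ?_) x
  have h2 := hu.sInf_le hx hy
  have h1 : sSup (u '' ball x ε) ≤ ⨆ z, u z :=
    csSup_le ⟨u x, mem_image_of_mem u (mem_ball_self hε)⟩
      (by rintro _ ⟨z, -, rfl⟩; exact le_ciSup hb z)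
  have := mul_le_mul_of_nonneg_left h1 (show 0 ≤ (1 + θ) / 2 by linarith)
  have := mul_le_mul_of_nonneg_left h2 (show 0 ≤ (1 - θ) / 2 by linarith)
  rw [(hu x hx).2.2]
  linarith

/-- A bounded infinity harmonic function is bounded below by its values on `Y`. -/
lemma InfinityHarmonicOn.ge_of_forall_ge {X : Type*} [MetricSpace X] [CompactSpace X]
    (hX : IsLengthSpace X) {Y : Set X} (hY : Y.Nonempty) {u : X → ℝ} {θ ε T : ℝ}
    (hε : 0 < ε) (hθ : -1 < θ) (hθ1 : θ ≤ 1) (hu : InfinityHarmonicOn θ ε Yᶜ u)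
    (hb : BddBelow (Set.range u)) (hT : ∀ y ∈ Y, T ≤ u y) (x : X) : T ≤ u x := by
  have hb' : BddAbove (Set.range fun z => -u z) := by
    obtain ⟨B, hB⟩ := hb
    exact ⟨-B, by rintro _ ⟨z, rfl⟩; exact neg_le_neg (hB ⟨z, rfl⟩)⟩
  refine neg_le_neg_iff.1 (hX.le_of_le_combination (v := fun z => -u z) (T := -T) hY
    (q := (1 + θ) / 2) hε (by linarith) (by linarith) hb' (fun y hy => neg_le_neg (hT y hy))
    (fun x hx y hy => ?_) x)
  have h2 := hu.le_sSup hx hy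
  have h1 : -(⨆ z, -u z) ≤ sInf (u '' ball x ε) :=
    le_csInf ⟨u x, mem_image_of_mem u (mem_ball_self hε)⟩
      (by rintro _ ⟨z, -, rfl⟩; exact neg_le.1 (le_ciSup hb' z))
  have := mul_le_mul_of_nonneg_left h1 (show 0 ≤ (1 - θ) / 2 by linarith)
  have := mul_le_mul_of_nonneg_left h2 (show 0 ≤ (1 + θ) / 2 by linarith)
  rw [(hu x hx).2.2]
  linarith

/-- A descent of more than `b` inside an `ε`-ball forces an ascent of more than
`b (1 - θ) / (1 + θ)`. -/
lemma InfinityHarmonicOn.exists_ascent {X : Type*} [MetricSpace X] {S : Set X} {u : X → ℝ}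
    {θ ε b : ℝ} (hθ : -1 < θ) (hθ1 : θ < 1) (hu : InfinityHarmonicOn θ ε S u) {x y : X}
    (hx : x ∈ S) (hy : y ∈ ball x ε) (hb : b < u x - u y) :
    ∃ z ∈ ball x ε, b * ((1 - θ) / (1 + θ)) < u z - u x := by
  have h1 := hu.sInf_le hx hy
  have h2 := (hu x hx).2.2
  have h3 : u x + b * ((1 - θ) / (1 + θ)) < sSup (u '' ball x ε) := by
    have hp : 0 < 1 + θ := by linarith
    have h4 : (1 - θ) * b < (1 - θ) * (u x - sInf (u '' ball x ε)) :=
      mul_lt_mul_of_pos_left (by linarith) (by linarith)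
    have h5 : b * ((1 - θ) / (1 + θ)) < sSup (u '' ball x ε) - u x := by
      rw [← mul_div_assoc, div_lt_iff₀ hp]
      linarith
    linarith
  obtain ⟨_, ⟨z, hz, rfl⟩, hlt⟩ := exists_lt_of_lt_csSup ⟨u y, mem_image_of_mem u hy⟩ h3
  exact ⟨z, hz, by linarith⟩

/-- Following near-maximal ascents, the increments shrink at most geometrically until `Y` is
reached. -/
lemma InfinityHarmonicOn.ascent_mul_le {X : Type*} [MetricSpace X] {Y : Set X}
    {u : X → ℝ} {θ ε B : ℝ} (hθ : 0 ≤ θ) (hθ1 : θ < 1)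
    (hu : InfinityHarmonicOn θ ε Yᶜ u) (hB : ∀ x, u x ≤ B) (k : ℕ) :
    ∀ x a, 0 ≤ a → k * ε ≤ infDist x Y → (∃ y ∈ ball x ε, a < u y - u x) →
      a * (k * ((1 - θ) / (1 + θ)) ^ k) ≤ B - u x := by
  set r := (1 - θ) / (1 + θ) with hr
  have hr0 : 0 ≤ r := div_nonneg (by linarith) (by linarith)
  have hr1 : r ≤ 1 := (div_le_one (by linarith)).2 (by linarith)
  induction k with
  | zero => intro x a _ _ _; simpa using hB x
  | succ k ih =>
    rintro x a ha hk ⟨y, hy, hay⟩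
    push_cast at hk ⊢
    have h1 : infDist x Y ≤ infDist y Y + dist x y := infDist_le_infDist_add_dist
    rw [mem_ball] at hy
    have hxy : dist x y < ε := by rwa [dist_comm]
    have hε : 0 < ε := dist_nonneg.trans_lt hxy
    have hkε : 0 ≤ k * ε := by positivity
    have hyY : y ∈ Yᶜ := fun h => by
      rw [infDist_zero_of_mem h] at h1
      linarith
    obtain ⟨z, hz, hzy⟩ := hu.exists_ascent (by linarith) hθ1 hyY (y := x) hxy hay
    have h2 := ih y (a * r) (mul_nonneg ha hr0) (by linarith) ⟨z, hz, hzy⟩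
    have h3 : a * r ^ (k + 1) ≤ a := mul_le_of_le_one_right ha (pow_le_one₀ hr0 hr1)
    calc a * ((k + 1) * r ^ (k + 1)) = a * r * (k * r ^ k) + a * r ^ (k + 1) := by ring
      _ ≤ B - u x := by linarith

/-- Oscillation bound on an `ε`-ball whose center is at distance at least `k ε` from `Y`. -/
lemma InfinityHarmonicOn.abs_sub_mul_le {X : Type*} [MetricSpace X] {Y : Set X}
    {u : X → ℝ} {θ ε A B : ℝ} (hθ : 0 ≤ θ) (hθ1 : θ < 1)
    (hu : InfinityHarmonicOn θ ε Yᶜ u) (hA : ∀ x, A ≤ u x) (hB : ∀ x, u x ≤ B) {k : ℕ} {x y : X}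
    (hx : x ∈ Yᶜ) (hk : k * ε ≤ infDist x Y) (hy : y ∈ ball x ε) :
    |u x - u y| * (k * ((1 - θ) / (1 + θ)) ^ (k + 1)) ≤ B - A := by
  set r := (1 - θ) / (1 + θ) with hr
  have hr0 : 0 ≤ r := div_nonneg (by linarith) (by linarith)
  have hr1 : r ≤ 1 := (div_le_one (by linarith)).2 (by linarith)
  have hc : 0 ≤ k * r ^ (k + 1) := by positivity
  have hAx := hA x
  have key : ∀ a, 0 ≤ a → a < |u x - u y| → a * (k * r ^ (k + 1)) ≤ B - A := by
    intro a ha hlt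
    rcases lt_abs.1 hlt with h | h
    · have h1 := hu.ascent_mul_le hθ hθ1 hB k x (a * r) (mul_nonneg ha hr0) hk
        (hu.exists_ascent (by linarith) hθ1 hx hy h)
      calc a * (k * r ^ (k + 1)) = a * r * (k * r ^ k) := by ring
        _ ≤ B - A := by linarith
    · have h1 := hu.ascent_mul_le hθ hθ1 hB k x a ha hk ⟨y, hy, by linarith⟩
      have h2 : a * (k * r ^ (k + 1)) ≤ a * (k * r ^ k) := by
        have := pow_le_pow_of_le_one hr0 hr1 k.le_succ
        gcongr
      linarith
  by_contra! hlt
  have hBA : A ≤ B := (hA x).trans (hB x)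
  rcases hc.eq_or_lt with h0 | hpos
  · rw [← h0, mul_zero] at hlt
    linarith
  obtain ⟨a, ha1, ha2⟩ := exists_between ((div_lt_iff₀ hpos).2 hlt)
  have := key a ((div_nonneg (by linarith) hc).trans ha1.le) ha2
  rw [div_lt_iff₀ hpos] at ha1
  linarith

/-- A bound on the increments over `ε`-balls centered at distance at least `t` from `Y`
propagates along chains. -/
lemma IsLengthSpace.abs_sub_le_of_local_bound {X : Type*} [MetricSpace X] (hX : IsLengthSpace X)
    {Y : Set X} {u : X → ℝ} {ε t c : ℝ} (hε : 0 < ε)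
    (h : ∀ x, t ≤ infDist x Y → ∀ y ∈ ball x ε, |u x - u y| ≤ c) (n : ℕ) :
    ∀ x y, dist x y < (n + 1) * ε → t + n * ε ≤ infDist x Y → |u x - u y| ≤ (n + 1) * c := by
  induction n with
  | zero =>
    intro x y hxy hx
    simpa using h x (by simpa using hx) y (by simpa [dist_comm] using hxy)
  | succ n ih =>
    intro x y hxy hx
    push_cast at hxy hx ⊢
    have hn : 0 < (n + 1) * ε := by positivity
    obtain ⟨z, hz1, hz2⟩ := hX.exists_dist_lt_dist_lt hε hn (x := x) (y := y) (by linarith)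
    have h1 : infDist x Y ≤ infDist z Y + dist x z := infDist_le_infDist_add_dist
    have h2 := ih z y hz2 (by linarith)
    have h3 := h x (by linarith) z (by simpa [dist_comm] using hz1)
    have h4 := abs_sub_le (u x) (u z) (u y)
    linarith

lemma exp_neg_four_mul_le_odds {θ : ℝ} (h0 : 0 ≤ θ) (h1 : θ ≤ 1 / 2) :
    Real.exp (-(4 * θ)) ≤ (1 - θ) / (1 + θ) := by
  rw [Real.exp_neg, inv_le_comm₀ (Real.exp_pos _) (div_pos (by linarith) (by linarith)), inv_div,
    div_le_iff₀ (by linarith)]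
  nlinarith [Real.add_one_le_exp (4 * θ)]

lemma dEps_comm {X : Type*} [MetricSpace X] (ε : ℝ) (x y : X) : dEps ε x y = dEps ε y x := by
  unfold dEps
  rw [dist_comm]
  congr 1
  exact propext eq_comm

lemma dist_le_dEps {X : Type*} [MetricSpace X] {ε : ℝ} (hε : 0 < ε) (x y : X) :
    dist x y ≤ dEps ε x y := by
  unfold dEps
  split_ifs with h
  · simp [h]
  · have := Int.lt_floor_add_one (dist x y / ε)
    rw [div_lt_iff₀ hε] at this
    linarith

/-- The Lipschitz estimate with the distance of the first point to `Y` in the denominator. -/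
lemma InfinityHarmonicOn.abs_sub_le_dEps {X : Type*} [MetricSpace X] (hX : IsLengthSpace X)
    {Y : Set X} {u : X → ℝ} {θ ε b D A B : ℝ} (hε : 0 < ε) (hε1 : ε ≤ 1) (hb : 0 ≤ b)
    (hθ : 0 ≤ θ) (hθ1 : θ ≤ 1 / 2) (hθb : θ ≤ b * ε) (hD : ∀ x, infDist x Y ≤ D)
    (hu : InfinityHarmonicOn θ ε Yᶜ u) (hA : ∀ x, A ≤ u x) (hB : ∀ x, u x ≤ B) {x₁ x₂ : X}
    (hx₁ : 2 * ε < infDist x₁ Y) :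
    |u x₁ - u x₂| ≤
      4 * Real.exp (4 * b * (D + 1)) * dEps ε x₁ x₂ * (B - A) / infDist x₁ Y := by
  set s := infDist x₁ Y with hs
  set E := Real.exp (4 * b * (D + 1)) with hE
  have hs0 : 0 < s := by linarith
  have hD0 : 0 ≤ D := hs0.le.trans (hD x₁)
  have hE1 : 1 ≤ E := Real.one_le_exp (by positivity)
  have hBA : 0 ≤ B - A := sub_nonneg.2 ((hA x₁).trans (hB x₁))
  by_cases hne : x₁ = x₂
  · simp [hne, dEps]
  by_cases hfar : s / 2 ≤ dist x₁ x₂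
  · have h1 : |u x₁ - u x₂| ≤ B - A :=
      abs_le.2 ⟨by linarith [hA x₁, hB x₂], by linarith [hA x₂, hB x₁]⟩
    refine h1.trans ((le_div_iff₀ hs0).2 ?_)
    have h2 : s ≤ 4 * E * dEps ε x₁ x₂ := by
      have := dist_le_dEps hε x₁ x₂
      nlinarith [dist_nonneg (x := x₁) (y := x₂)]
    calc (B - A) * s ≤ (B - A) * (4 * E * dEps ε x₁ x₂) := by gcongr
      _ = _ := by ring
  push Not at hfar
  have hloc : ∀ x, s / 2 ≤ infDist x Y → ∀ y ∈ ball x ε,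
      |u x - u y| ≤ 4 * E * ε * (B - A) / s := by
    intro x hx y hy
    set k := ⌊infDist x Y / ε⌋₊ with hk
    have hkle : k * ε ≤ infDist x Y :=
      (le_div_iff₀ hε).1 (Nat.floor_le (div_nonneg infDist_nonneg hε.le))
    have hklt : infDist x Y < (k + 1) * ε := (div_lt_iff₀ hε).1 (Nat.lt_floor_add_one _)
    have hk1 : (1 : ℝ) ≤ k := by
      exact_mod_cast Nat.le_floor (by rw [Nat.cast_one, le_div_iff₀ hε]; linarith)
    have hxY : x ∈ Yᶜ := fun h => by
      rw [infDist_zero_of_mem h] at hx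
      linarith
    have h1 := hu.abs_sub_mul_le hθ (by linarith) hA hB hxY hkle hy
    have h2 : E⁻¹ ≤ ((1 - θ) / (1 + θ)) ^ (k + 1) := by
      calc E⁻¹ = Real.exp (-(4 * b * (D + 1))) := (Real.exp_neg _).symm
        _ ≤ Real.exp ((k + 1 : ℕ) * -(4 * θ)) := by
          apply Real.exp_le_exp.2
          push_cast
          have h3 : (k + 1) * θ ≤ (k + 1) * (b * ε) := by gcongr
          have h4 : (k + 1) * ε ≤ D + 1 := by linarith [hD x]
          have h5 := mul_le_mul_of_nonneg_left h4 hb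
          linarith
        _ = Real.exp (-(4 * θ)) ^ (k + 1) := Real.exp_nat_mul _ _
        _ ≤ _ := by
          gcongr
          exact exp_neg_four_mul_le_odds hθ hθ1
    have h3 : s / (4 * ε) ≤ k := by
      rw [div_le_iff₀ (by positivity)]
      nlinarith
    have h4 : |u x - u y| * (s / (4 * ε) * E⁻¹) ≤ B - A := le_trans (by gcongr) h1
    have hE0 : 0 < E := by linarith
    rw [show s / (4 * ε) * E⁻¹ = s / (4 * E * ε) by field_simp, ← mul_div_assoc,
      div_le_iff₀ (by positivity)] at h4
    rw [le_div_iff₀ hs0]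
    linarith
  set n := ⌊dist x₁ x₂ / ε⌋₊ with hn
  have hnle : n * ε ≤ dist x₁ x₂ :=
    (le_div_iff₀ hε).1 (Nat.floor_le (div_nonneg dist_nonneg hε.le))
  have hnlt : dist x₁ x₂ < (n + 1) * ε := (div_lt_iff₀ hε).1 (Nat.lt_floor_add_one _)
  have hmain := hX.abs_sub_le_of_local_bound hε hloc n x₁ x₂ hnlt (by linarith)
  have hd : dEps ε x₁ x₂ = (n + 1) * ε := by
    rw [dEps, if_neg hne, ← natCast_floor_eq_intCast_floor (div_nonneg dist_nonneg hε.le), ← hn]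
    ring
  rw [hd]
  exact hmain.trans_eq (by ring)

/-- Uniform Lipschitz bound away from `Y`: there are `C, ε₀ > 0` such that
for all `ε ∈ (0,ε₀)` and `θ ∈ (0,1)` with `|θ − βε/2| ≤ Kε²`, the unique bounded
`(θ,ε)`-infinity harmonic extension `u` of `F` satisfies, for all `x₁,x₂ ∈ X∖Y` with
`2ε < min{d(x₁,Y), d(x₂,Y)}` and `s := max{d(x₁,Y), d(x₂,Y)}`,
`|u(x₁) − u(x₂)| ≤ C·d^ε(x₁,x₂)·M/s`, where `M = sup_Y F − inf_Y F`. -/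
theorem uniform_lipschitz_away_from_boundary
    {X : Type*} [MetricSpace X] [CompactSpace X] (hX : IsLengthSpace X)
    (Y : Set X) (hYne : Y.Nonempty) (hYcl : IsClosed Y)
    (F : Y → ℝ) (L : NNReal) (hF : LipschitzWith L F)
    (β K : ℝ) (hβ : 0 < β) (hK : 0 < K) :
    ∃ C : ℝ, 0 < C ∧ ∃ ε₀ : ℝ, 0 < ε₀ ∧
      ∀ ε : ℝ, 0 < ε → ε < ε₀ →
      ∀ θ : ℝ, θ ∈ Set.Ioo (0 : ℝ) 1 → |θ - β * ε / 2| ≤ K * ε ^ 2 →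
      ∀ u : X → ℝ, (∃ C' : ℝ, ∀ x, |u x| ≤ C') → (∀ y : Y, u y = F y) →
        InfinityHarmonicOn θ ε Yᶜ u →
      ∀ x₁ x₂ : X, x₁ ∈ Yᶜ → x₂ ∈ Yᶜ →
        2 * ε < min (Metric.infDist x₁ Y) (Metric.infDist x₂ Y) →
        |u x₁ - u x₂| ≤ C * dEps ε x₁ x₂ * ((⨆ y : Y, F y) - ⨅ y : Y, F y) /
          max (Metric.infDist x₁ Y) (Metric.infDist x₂ Y) := by
  have : CompactSpace Y := isCompact_iff_compactSpace.1 hYcl.isCompact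
  have hrange : IsCompact (Set.range F) := isCompact_range hF.continuous
  set b := β / 2 + K with hb
  have hb0 : 0 < b := by positivity
  set D := diam (Set.univ : Set X) with hD
  have hinfD : ∀ x, infDist x Y ≤ D := fun x => by
    obtain ⟨y, hy⟩ := hYne
    exact (infDist_le_dist_of_mem hy).trans
      (dist_le_diam_of_mem isCompact_univ.isBounded trivial trivial)
  refine ⟨4 * Real.exp (4 * b * (D + 1)), by positivity, min 1 (1 / (2 * b)), by positivity, ?_⟩
  rintro ε hε hε₀ θ ⟨hθ0, hθ1⟩ hθ u ⟨C', hC'⟩ huF hu x₁ x₂ - - hmin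
  have hε1 : ε < 1 := hε₀.trans_le (min_le_left _ _)
  have hbε : b * ε < 1 / 2 := by
    have h1 := hε₀.trans_le (min_le_right _ _)
    rw [lt_div_iff₀ (by positivity)] at h1
    linarith
  have hθb : θ ≤ b * ε := by
    have h1 := (abs_le.1 hθ).2
    have h2 : K * ε ^ 2 ≤ K * ε := by
      gcongr
      nlinarith
    rw [hb]
    linarith
  have hB := hu.le_of_forall_le hX hYne hε (by linarith) hθ1
    ⟨C', by rintro _ ⟨x, rfl⟩; exact (abs_le.1 (hC' x)).2⟩ (T := ⨆ y, F y)
    (fun y hy => (huF ⟨y, hy⟩).trans_le (le_ciSup hrange.bddAbove _))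
  have hA := hu.ge_of_forall_ge hX hYne hε (by linarith) hθ1.le
    ⟨-C', by rintro _ ⟨x, rfl⟩; exact (abs_le.1 (hC' x)).1⟩ (T := ⨅ y, F y)
    (fun y hy => (ciInf_le hrange.bddBelow _).trans_eq (huF ⟨y, hy⟩).symm)
  rcases le_total (infDist x₁ Y) (infDist x₂ Y) with h | h
  · rw [max_eq_right h, abs_sub_comm, dEps_comm]
    exact hu.abs_sub_le_dEps hX hε hε1.le hb0.le hθ0.le (by linarith) hθb hinfD hA hB
      (hmin.trans_le (min_le_right _ _))
  · rw [max_eq_left h]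
    exact hu.abs_sub_le_dEps hX hε hε1.le hb0.le hθ0.le (by linarith) hθb hinfD hA hB
      (hmin.trans_le (min_le_left _ _))
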